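/- arXiv:1910.10889 — 3 statements merged into one kernel-verified Lean document; each statement's English description precedes it below -/
import Mathlib

section
/- Let R be a binary relation symbol, let A be a set of first-order Σ-sentences none of which mentions R, and let ρ be an execution containing no letter of the form ⌜assume(¬R(x,y))⌝. Then: (1) ρ is feasible modulo A ∪ A_STO^R if and only if ρ is feasible modulo A ∪ A_SPO^R; and (2) ρ is coherent modulo A ∪ A_STO^R if and only if ρ is coherent modulo A ∪ A_SPO^R. -/
namespace PVMA

open FirstOrder FirstOrder.Language


/-! ### Executions -/

/-- The alphabet Π of program letters. -/
inductive ProgLetter (L : FirstOrder.Language.{0,0}) (V : Type) : Type where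
  | assign (x y : V)
  | call (x : V) {n : ℕ} (f : L.Functions n) (z : Fin n → V)
  | assumeEq (x y : V)
  | assumeNe (x y : V)
  | assumeRel {n : ℕ} (r : L.Relations n) (z : Fin n → V)
  | assumeNRel {n : ℕ} (r : L.Relations n) (z : Fin n → V)

/-- Executions are finite words over Π. -/
abbrev Exec (L : FirstOrder.Language.{0,0}) (V : Type) := List (ProgLetter L V)

variable {L : FirstOrder.Language.{0,0}} {V : Type}

section TEval

variable [DecidableEq V]

/-- One step of the symbolic state transformer. -/
def stepState (st : V → L.Term Empty) : ProgLetter L V → (V → L.Term Empty)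
  | .assign x y => Function.update st x (st y)
  | .call x f z => Function.update st x (Term.func f fun i => st (z i))
  | _ => st

/-- `TEval init ρ x` is the ground term stored in variable `x` after execution `ρ`. -/
def TEval (init : V → L.Constants) (ρ : Exec L V) : V → L.Term Empty :=
  ρ.foldl stepState (fun x => Constants.term (init x))

/-- The set of terms computed by an execution. -/
def TermsOf (init : V → L.Constants) (ρ : Exec L V) : Set (L.Term Empty) :=
  { t | ∃ σ x, σ <+: ρ ∧ TEval init σ x = t }

end TEval

/-- Ground literals over the signature. -/
inductive GLit (L : FirstOrder.Language.{0,0}) : Type where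
  | eq (t₁ t₂ : L.Term Empty)
  | ne (t₁ t₂ : L.Term Empty)
  | rel {n : ℕ} (r : L.Relations n) (ts : Fin n → L.Term Empty)
  | nrel {n : ℕ} (r : L.Relations n) (ts : Fin n → L.Term Empty)

/-- The ground literal contributed by an assume letter, given the current symbolic state. -/
def litOf (st : V → L.Term Empty) : ProgLetter L V → Option (GLit L)
  | .assumeEq x y => some (.eq (st x) (st y))
  | .assumeNe x y => some (.ne (st x) (st y))
  | .assumeRel r z => some (.rel r fun i => st (z i))
  | .assumeNRel r z => some (.nrel r fun i => st (z i))
  | _ => none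

/-- κ(ρ): the set of ground literals accumulated by the execution ρ. -/
def kappa [DecidableEq V] (init : V → L.Constants) (ρ : Exec L V) : Set (GLit L) :=
  { l | ∃ σ a, (σ ++ [a]) <+: ρ ∧ litOf (TEval init σ) a = some l }

/-! ### Structures -/

/-- A bundled (nonempty) first-order structure for the language `L`. -/
structure Struc (L : FirstOrder.Language.{0,0}) where
  carrier : Type
  inst : L.Structure carrier
  nonempty : Nonempty carrier

/-- Evaluation of a ground term in a structure. -/
def Struc.evalT (M : Struc L) (t : L.Term Empty) : M.carrier :=
  @Term.realize L M.carrier M.inst Empty Empty.elim t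

/-- Satisfaction of a ground literal. -/
def Struc.SatLit (M : Struc L) : GLit L → Prop
  | .eq t₁ t₂ => M.evalT t₁ = M.evalT t₂
  | .ne t₁ t₂ => M.evalT t₁ ≠ M.evalT t₂
  | .rel r ts => @Structure.RelMap L M.carrier M.inst _ r (fun i => M.evalT (ts i))
  | .nrel r ts => ¬ @Structure.RelMap L M.carrier M.inst _ r (fun i => M.evalT (ts i))

/-- Satisfaction of a sentence. -/
def Struc.Sat (M : Struc L) (φ : L.Sentence) : Prop :=
  @Sentence.Realize L M.carrier M.inst φ

/-- Satisfaction of a theory. -/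
def Struc.SatTheory (M : Struc L) (A : L.Theory) : Prop := ∀ φ ∈ A, M.Sat φ

variable [DecidableEq V]

/-- Feasibility of an execution in a structure. -/
def FeasibleIn (M : Struc L) (init : V → L.Constants) (ρ : Exec L V) : Prop :=
  ∀ σ a, (σ ++ [a]) <+: ρ → ∀ l, litOf (TEval init σ) a = some l → M.SatLit l

/-- Feasibility modulo a set of axioms. -/
def FeasibleModulo (A : L.Theory) (init : V → L.Constants) (ρ : Exec L V) : Prop :=
  ∃ M : Struc L, M.SatTheory A ∧ FeasibleIn M init ρ

/-- `EntailsEq A K t₁ t₂` : the axioms `A` together with the ground literals `K`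
entail the equality `t₁ = t₂` (written `t₁ ≅_{A ∪ K} t₂`). -/
def EntailsEq (A : L.Theory) (K : Set (GLit L)) (t₁ t₂ : L.Term Empty) : Prop :=
  ∀ M : Struc L, M.SatTheory A → (∀ l ∈ K, M.SatLit l) → M.evalT t₁ = M.evalT t₂

/-! ### Coherence -/

/-- Whether a letter is an assume statement. -/
def IsAssume : ProgLetter L V → Prop
  | .assumeEq _ _ => True
  | .assumeNe _ _ => True
  | .assumeRel _ _ => True
  | .assumeNRel _ _ => True
  | _ => False

/-- The memoizing property modulo axioms `A`. -/
def Memoizing (A : L.Theory) (init : V → L.Constants) (ρ : Exec L V) : Prop :=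
  ∀ (σ : Exec L V) (x : V) {n : ℕ} (f : L.Functions n) (z : Fin n → V),
    (σ ++ [ProgLetter.call x f z]) <+: ρ →
    (∃ t' ∈ TermsOf init σ,
        EntailsEq A (kappa init σ) t' (Term.func f fun i => TEval init σ (z i))) →
    ∃ y : V, EntailsEq A (kappa init σ) (TEval init σ y) (Term.func f fun i => TEval init σ (z i))

/-- The early-assumes property modulo axioms `A`. -/
def EarlyAssumes (A : L.Theory) (init : V → L.Constants) (ρ : Exec L V) : Prop :=
  ∀ (σ : Exec L V) (a : ProgLetter L V), (σ ++ [a]) <+: ρ → IsAssume a →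
    ∀ t ∈ TermsOf init σ,
      (∀ x : V, ¬ EntailsEq A (kappa init σ) (TEval init σ x) t) →
      ∀ t' ∈ TermsOf init σ,
        EntailsEq A (kappa init (σ ++ [a])) t t' → EntailsEq A (kappa init σ) t t'

/-- Coherence of an execution modulo axioms `A`. -/
def Coherent (A : L.Theory) (init : V → L.Constants) (ρ : Exec L V) : Prop :=
  Memoizing A init ρ ∧ EarlyAssumes A init ρ

end PVMA
namespace PVMA

open FirstOrder FirstOrder.Language


variable {L : FirstOrder.Language.{0,0}} {V : Type}

/-! ### Axiom sentences -/

/-- φ_refl^R = ∀x. R(x,x) -/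
def phiRefl (r : L.Relations 2) : L.Sentence := ∀' r.boundedFormula₂ (&0) &0

/-- φ_irref^R = ∀x. ¬R(x,x) -/
def phiIrref (r : L.Relations 2) : L.Sentence := ∀' ∼(r.boundedFormula₂ (&0) &0)

/-- φ_symm^R = ∀x y. R(x,y) → R(y,x) -/
def phiSymm (r : L.Relations 2) : L.Sentence :=
  ∀' ∀' (r.boundedFormula₂ (&0) &1 ⟹ r.boundedFormula₂ (&1) &0)

/-- φ_trans^R = ∀x y z. R(x,y) ∧ R(y,z) → R(x,z) -/
def phiTrans (r : L.Relations 2) : L.Sentence :=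
  ∀' ∀' ∀' ((r.boundedFormula₂ (&0) &1 ⊓ r.boundedFormula₂ (&1) &2) ⟹ r.boundedFormula₂ (&0) &2)

/-- ∀ x y. x = y ∨ R(x,y) ∨ R(y,x) (totality) -/
def phiTotal (r : L.Relations 2) : L.Sentence :=
  ∀' ∀' (Term.bdEqual (&0) (&1) ⊔ r.boundedFormula₂ (&0) &1 ⊔ r.boundedFormula₂ (&1) &0)

/-- A_STO^R = {φ_irref^R, φ_trans^R, totality} -/
def ASTO (r : L.Relations 2) : L.Theory := {phiIrref r, phiTrans r, phiTotal r}

/-- A_SPO^R = {φ_irref^R, φ_trans^R} -/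
def ASPO (r : L.Relations 2) : L.Theory := {phiIrref r, phiTrans r}

/-- φ_comm^f = ∀x y. f(x,y) = f(y,x) -/
def phiComm (f : L.Functions 2) : L.Sentence :=
  ∀' ∀' Term.bdEqual (Functions.apply₂ f (&0) &1) (Functions.apply₂ f (&1) &0)

/-- φ_idem^f = ∀x. f(f(x)) = f(x) -/
def phiIdem (f : L.Functions 1) : L.Sentence :=
  ∀' Term.bdEqual (Functions.apply₁ f (Functions.apply₁ f &0)) (Functions.apply₁ f &0)

/-- φ_assoc^f = ∀x y z. f(f(x,y),z) = f(x,f(y,z)) -/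
def phiAssoc (f : L.Functions 2) : L.Sentence :=
  ∀' ∀' ∀' Term.bdEqual (Functions.apply₂ f (Functions.apply₂ f (&0) &1) &2)
    (Functions.apply₂ f (&0) (Functions.apply₂ f (&1) &2))

/-! ### Occurrence of symbols in formulas -/

/-- A term mentions a function symbol. -/
def TermMentionsFunc (fs : Σ n, L.Functions n) {α : Type} : L.Term α → Prop
  | .var _ => False
  | .func g ts => (⟨_, g⟩ : Σ n, L.Functions n) = fs ∨ ∃ i, TermMentionsFunc fs (ts i)

/-- A bounded formula mentions a relation symbol. -/
def MentionsRel (R : Σ n, L.Relations n) {α : Type} : ∀ {n : ℕ}, L.BoundedFormula α n → Prop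
  | _, .falsum => False
  | _, .equal _ _ => False
  | _, .rel r _ => (⟨_, r⟩ : Σ n, L.Relations n) = R
  | _, .imp φ ψ => MentionsRel R φ ∨ MentionsRel R ψ
  | _, .all φ => MentionsRel R φ

/-- A bounded formula mentions a function symbol. -/
def MentionsFunc (fs : Σ n, L.Functions n) {α : Type} : ∀ {n : ℕ}, L.BoundedFormula α n → Prop
  | _, .falsum => False
  | _, .equal t₁ t₂ => TermMentionsFunc fs t₁ ∨ TermMentionsFunc fs t₂
  | _, .rel _ ts => ∃ i, TermMentionsFunc fs (ts i)
  | _, .imp φ ψ => MentionsFunc fs φ ∨ MentionsFunc fs ψ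
  | _, .all φ => MentionsFunc fs φ

end PVMA
namespace PVMA

open FirstOrder FirstOrder.Language


variable {L : FirstOrder.Language.{0,0}} {V : Type}

/-! ### Programs -/

/-- Atomic conditions. -/
inductive AtomCond (L : FirstOrder.Language.{0,0}) (V : Type) : Type where
  | eq (x y : V)
  | ne (x y : V)
  | rel {n : ℕ} (r : L.Relations n) (z : Fin n → V)
  | nrel {n : ℕ} (r : L.Relations n) (z : Fin n → V)

/-- The assume letter corresponding to an atomic condition. -/
def AtomCond.toLetter : AtomCond L V → ProgLetter L V
  | .eq x y => .assumeEq x y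
  | .ne x y => .assumeNe x y
  | .rel r z => .assumeRel r z
  | .nrel r z => .assumeNRel r z

/-- The assume letter corresponding to the negation of an atomic condition. -/
def AtomCond.negLetter : AtomCond L V → ProgLetter L V
  | .eq x y => .assumeNe x y
  | .ne x y => .assumeEq x y
  | .rel r z => .assumeNRel r z
  | .nrel r z => .assumeRel r z

/-- Programs. -/
inductive Prog (L : FirstOrder.Language.{0,0}) (V : Type) : Type where
  | skip
  | assign (x y : V)
  | call (x : V) {n : ℕ} (f : L.Functions n) (z : Fin n → V)
  | passume (c : AtomCond L V)
  | seq (s₁ s₂ : Prog L V)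
  | ite (c : AtomCond L V) (s₁ s₂ : Prog L V)
  | while (c : AtomCond L V) (s : Prog L V)

/-- The set of executions of a program. -/
def ExecSet : Prog L V → Set (Exec L V)
  | .skip => {[]}
  | .assign x y => {[.assign x y]}
  | .call x f z => {[.call x f z]}
  | .passume c => {[c.toLetter]}
  | .seq s₁ s₂ => { ρ | ∃ ρ₁ ∈ ExecSet s₁, ∃ ρ₂ ∈ ExecSet s₂, ρ = ρ₁ ++ ρ₂ }
  | .ite c s₁ s₂ =>
      (fun ρ => c.toLetter :: ρ) '' ExecSet s₁ ∪ (fun ρ => c.negLetter :: ρ) '' ExecSet s₂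
  | .while c s =>
      { ρ | ∃ bodies : List (Exec L V), (∀ b ∈ bodies, b ∈ ExecSet s) ∧
          ρ = (bodies.map (fun b => c.toLetter :: b)).flatten ++ [c.negLetter] }

/-- Quantifier-free postconditions. -/
inductive Post (L : FirstOrder.Language.{0,0}) (V : Type) : Type where
  | eq (x y : V)
  | rel {n : ℕ} (r : L.Relations n) (z : Fin n → V)
  | por (φ ψ : Post L V)
  | pnot (φ : Post L V)

/-- Truth of a postcondition in a structure under a valuation of the variables. -/
def Post.Holds (M : Struc L) (v : V → M.carrier) : Post L V → Prop
  | .eq x y => v x = v y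
  | .rel r z => @Structure.RelMap L M.carrier M.inst _ r (fun i => v (z i))
  | .por φ ψ => φ.Holds M v ∨ ψ.Holds M v
  | .pnot φ => ¬ φ.Holds M v

variable [DecidableEq V]

/-- A program satisfies a postcondition modulo axioms `A`. -/
def Satisfies (A : L.Theory) (init : V → L.Constants) (s : Prog L V) (φ : Post L V) : Prop :=
  ∀ M : Struc L, M.SatTheory A → ∀ ρ ∈ ExecSet s, FeasibleIn M init ρ →
    φ.Holds M (fun x => M.evalT (TEval init ρ x))

/-- A program is coherent modulo `A` if all its executions are. -/
def CoherentProg (A : L.Theory) (init : V → L.Constants) (s : Prog L V) : Prop :=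
  ∀ ρ ∈ ExecSet s, Coherent A init ρ

end PVMA
namespace PVMA

open FirstOrder FirstOrder.Language


variable {L : FirstOrder.Language.{0,0}} {V : Type}

/-! ### Relational closures and closure extensions -/

/-- The three closure kinds for relational axioms. -/
inductive ClosKind : Type where
  | refl
  | irref
  | symm

/-- The axiom corresponding to a closure kind. -/
def ClosKind.phi : ClosKind → (L.Relations 2) → L.Sentence
  | .refl => phiRefl
  | .irref => phiIrref
  | .symm => phiSymm

/-- The p-closure of a binary relation: the smallest reflexive/symmetric relation containing
it, respectively the largest irreflexive relation contained in it. -/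
def RelClos {α : Type} : ClosKind → (α → α → Prop) → (α → α → Prop)
  | .refl, r => fun a b => r a b ∨ a = b
  | .irref, r => fun a b => r a b ∧ a ≠ b
  | .symm, r => fun a b => r a b ∨ r b a

/-- The interpretation of a binary relation symbol in a structure, as a binary relation. -/
def Struc.rel2 (M : Struc L) (R : L.Relations 2) : M.carrier → M.carrier → Prop :=
  fun a b => @Structure.RelMap L M.carrier M.inst 2 R ![a, b]

open Classical in
/-- Replace the interpretation of the binary relation symbol `R` by the relation `r`. -/
noncomputable def Struc.withRel2 (M : Struc L) (R : L.Relations 2)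
    (r : M.carrier → M.carrier → Prop) : Struc L where
  carrier := M.carrier
  inst :=
    { funMap := fun f v => @Structure.funMap L M.carrier M.inst _ f v
      RelMap := fun {n} S v =>
        if h : (⟨n, S⟩ : Σ k, L.Relations k) = ⟨2, R⟩ then
          r (v (Fin.cast (congrArg Sigma.fst h).symm 0))
            (v (Fin.cast (congrArg Sigma.fst h).symm 1))
        else @Structure.RelMap L M.carrier M.inst n S v }
  nonempty := M.nonempty

/-- The (p,R)-closure extension of a structure. -/
noncomputable def closureExt (M : Struc L) (p : ClosKind) (R : L.Relations 2) : Struc L :=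
  M.withRel2 R (RelClos p (M.rel2 R))

/-- The (p,R)-transitive-closure extension of a structure. -/
noncomputable def transClosureExt (M : Struc L) (p : ClosKind) (R : L.Relations 2) : Struc L :=
  (closureExt M p R).withRel2 R (Relation.TransGen ((closureExt M p R).rel2 R))

/-- A theory is invariant under (p,R)-closure extension. -/
def InvariantClos (A : L.Theory) (p : ClosKind) (R : L.Relations 2) : Prop :=
  ∀ M : Struc L, M.SatTheory A → (closureExt M p R).SatTheory A

/-- A theory is invariant under (p,R)-transitive-closure extension. -/
def InvariantTransClos (A : L.Theory) (p : ClosKind) (R : L.Relations 2) : Prop :=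
  ∀ M : Struc L, M.SatTheory A → (transClosureExt M p R).SatTheory A

/-! ### The instrumentation homomorphisms h_p^R -/

/-- Auxiliary letters inserted by `h_refl^R` after a letter. -/
def reflExtra (R : L.Relations 2) : ProgLetter L V → List (ProgLetter L V)
  | .call x _ _ => [ProgLetter.assumeRel R ![x, x] ]
  | _ => []

/-- Auxiliary letters inserted by `h_irref^R` after a letter. -/
def irrefExtra (R : L.Relations 2) : ProgLetter L V → List (ProgLetter L V)
  | .call x _ _ => [ProgLetter.assumeNRel R ![x, x] ]
  | _ => []

open Classical in
/-- Auxiliary letters inserted by `h_symm^R` after a letter. -/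
noncomputable def symmExtra (R : L.Relations 2) : ProgLetter L V → List (ProgLetter L V)
  | .assumeRel (n := nn) r z =>
      if h : (⟨nn, r⟩ : Σ k, L.Relations k) = ⟨2, R⟩ then
        [ProgLetter.assumeRel R ![z (Fin.cast (congrArg Sigma.fst h).symm 1),
                                  z (Fin.cast (congrArg Sigma.fst h).symm 0)] ]
      else []
  | .assumeNRel (n := nn) r z =>
      if h : (⟨nn, r⟩ : Σ k, L.Relations k) = ⟨2, R⟩ then
        [ProgLetter.assumeNRel R ![z (Fin.cast (congrArg Sigma.fst h).symm 1),
                                   z (Fin.cast (congrArg Sigma.fst h).symm 0)] ]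
      else []
  | _ => []

/-- The homomorphism h_p^R applied to an execution. -/
noncomputable def hMap [Fintype V] (p : ClosKind) (R : L.Relations 2) (ρ : Exec L V) :
    Exec L V :=
  match p with
  | .refl =>
      ((Finset.univ : Finset V).toList.map fun x => ProgLetter.assumeRel R ![x, x]) ++
        (ρ.map fun a => a :: reflExtra R a).flatten
  | .irref => (ρ.map fun a => a :: irrefExtra R a).flatten
  | .symm => (ρ.map fun a => a :: symmExtra R a).flatten

/-! ### One element extensions and the homomorphisms for function axioms -/

/-- The one-element extension of a structure. -/
noncomputable def oneExt (M : Struc L) : Struc L where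
  carrier := Option M.carrier
  inst :=
    { funMap := fun {n} g v =>
        if h : ∀ i, (v i).isSome then
          some (@Structure.funMap L M.carrier M.inst n g fun i => (v i).get (h i))
        else none
      RelMap := fun {n} S v =>
        ∃ w : Fin n → M.carrier, (∀ i, v i = some (w i)) ∧
          @Structure.RelMap L M.carrier M.inst n S w }
  nonempty := ⟨none⟩

/-- A theory is invariant under one-element extension. -/
def Invariant1Ext (A : L.Theory) : Prop :=
  ∀ M : Struc L, M.SatTheory A → (oneExt M).SatTheory A

/-- Renaming the variables of a letter. -/
def ProgLetter.mapVar {W : Type} (j : V → W) : ProgLetter L V → ProgLetter L W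
  | .assign x y => .assign (j x) (j y)
  | .call x f z => .call (j x) f (j ∘ z)
  | .assumeEq x y => .assumeEq (j x) (j y)
  | .assumeNe x y => .assumeNe (j x) (j y)
  | .assumeRel r z => .assumeRel r (j ∘ z)
  | .assumeNRel r z => .assumeNRel r (j ∘ z)

open Classical in
/-- Auxiliary letters inserted by `h_idem^f` after a letter; `none` plays the role of
the fresh variable v*. -/
noncomputable def idemExtra (f : L.Functions 1) :
    ProgLetter L V → List (ProgLetter L (Option V))
  | .call x (n := nn) g _ =>
      if _ : (⟨nn, g⟩ : Σ k, L.Functions k) = ⟨1, f⟩ then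
        [ProgLetter.call none f ![some x], ProgLetter.assumeEq (some x) none]
      else []
  | _ => []

open Classical in
/-- Auxiliary letters inserted by `h_comm^f` after a letter; `none` plays the role of
the fresh variable v*. -/
noncomputable def commExtra (f : L.Functions 2) :
    ProgLetter L V → List (ProgLetter L (Option V))
  | .call x (n := nn) g z =>
      if h : (⟨nn, g⟩ : Σ k, L.Functions k) = ⟨2, f⟩ then
        [ProgLetter.call none f ![some (z (Fin.cast (congrArg Sigma.fst h).symm 1)),
                                  some (z (Fin.cast (congrArg Sigma.fst h).symm 0))],
         ProgLetter.assumeEq (some x) none]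
      else []
  | _ => []

/-- The homomorphism h_idem^f. -/
noncomputable def hIdem (f : L.Functions 1) (ρ : Exec L V) : Exec L (Option V) :=
  (ρ.map fun a => a.mapVar some :: idemExtra f a).flatten

/-- The homomorphism h_comm^f. -/
noncomputable def hComm (f : L.Functions 2) (ρ : Exec L V) : Exec L (Option V) :=
  (ρ.map fun a => a.mapVar some :: commExtra f a).flatten

/-- Extension of the initial-constants assignment to the fresh variable v*. -/
def extInit (init : V → L.Constants) (cstar : L.Constants) : Option V → L.Constants
  | some x => init x
  | none => cstar

/-! ### The minimal model -/

/-- Congruence closure of a set of pairs of ground terms. -/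
inductive CongCl (E : L.Term Empty → L.Term Empty → Prop) :
    L.Term Empty → L.Term Empty → Prop
  | base {t₁ t₂} : E t₁ t₂ → CongCl E t₁ t₂
  | refl (t) : CongCl E t t
  | symm {t₁ t₂} : CongCl E t₁ t₂ → CongCl E t₂ t₁
  | trans {t₁ t₂ t₃} : CongCl E t₁ t₂ → CongCl E t₂ t₃ → CongCl E t₁ t₃
  | congr {n : ℕ} (f : L.Functions n) {ts ss : Fin n → L.Term Empty} :
      (∀ i, CongCl E (ts i) (ss i)) → CongCl E (.func f ts) (.func f ss)

/-- The setoid of ground terms given by congruence closure. -/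
def congSetoid (E : L.Term Empty → L.Term Empty → Prop) : Setoid (L.Term Empty) :=
  ⟨CongCl E, ⟨fun t => .refl t, fun h => h.symm, fun h h' => h.trans h'⟩⟩

/-- The equality pairs contained in a set of ground literals. -/
def eqPairs (K : Set (GLit L)) : L.Term Empty → L.Term Empty → Prop :=
  fun t₁ t₂ => GLit.eq t₁ t₂ ∈ K

/-- The minimal model of an execution. -/
noncomputable def minimalModel [DecidableEq V] [Nonempty V]
    (init : V → L.Constants) (ρ : Exec L V) : Struc L :=
  let S : Setoid (L.Term Empty) := congSetoid (eqPairs (kappa init ρ))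
  { carrier := Quotient S
    inst :=
      { funMap := fun {n} f v => Quotient.mk S (Term.func f fun i => (v i).out)
        RelMap := fun {n} r v =>
          ∃ ts : Fin n → L.Term Empty,
            (∀ i, Quotient.mk S (ts i) = v i) ∧ GLit.rel r ts ∈ kappa init ρ }
    nonempty := ⟨Quotient.mk S (Constants.term (init (Classical.arbitrary V)))⟩ }

end PVMA
namespace PVMA

open FirstOrder FirstOrder.Language

variable {L : FirstOrder.Language.{0,0}}

/-! ### Encodings of inputs as natural numbers -/

/-- Encoding of lists of naturals. -/
def encL : List ℕ → ℕ := fun l => Encodable.encode l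

section Enc

variable (encF : (Σ n, L.Functions n) → ℕ) (encR : (Σ n, L.Relations n) → ℕ)

/-- Encoding of letters (variables are `Fin m`). -/
def encLetter {m : ℕ} : ProgLetter L (Fin m) → ℕ
  | .assign x y => encL [0, x.val, y.val]
  | .call x f z => encL [1, x.val, encF ⟨_, f⟩, encL (List.ofFn fun i => (z i).val)]
  | .assumeEq x y => encL [2, x.val, y.val]
  | .assumeNe x y => encL [3, x.val, y.val]
  | .assumeRel r z => encL [4, encR ⟨_, r⟩, encL (List.ofFn fun i => (z i).val)]
  | .assumeNRel r z => encL [5, encR ⟨_, r⟩, encL (List.ofFn fun i => (z i).val)]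

/-- Encoding of executions. -/
def encExec {m : ℕ} (ρ : Exec L (Fin m)) : ℕ := encL (ρ.map (encLetter encF encR))

/-- Encoding of atomic conditions. -/
def encCond {m : ℕ} : AtomCond L (Fin m) → ℕ
  | .eq x y => encL [0, x.val, y.val]
  | .ne x y => encL [1, x.val, y.val]
  | .rel r z => encL [2, encR ⟨_, r⟩, encL (List.ofFn fun i => (z i).val)]
  | .nrel r z => encL [3, encR ⟨_, r⟩, encL (List.ofFn fun i => (z i).val)]

/-- Encoding of programs. -/
def encProg {m : ℕ} : Prog L (Fin m) → ℕ
  | .skip => encL [0]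
  | .assign x y => encL [1, x.val, y.val]
  | .call x f z => encL [2, x.val, encF ⟨_, f⟩, encL (List.ofFn fun i => (z i).val)]
  | .passume c => encL [3, encCond encR c]
  | .seq s₁ s₂ => encL [4, encProg s₁, encProg s₂]
  | .ite c s₁ s₂ => encL [5, encCond encR c, encProg s₁, encProg s₂]
  | .while c s => encL [6, encCond encR c, encProg s]

/-- Encoding of postconditions. -/
def encPost {m : ℕ} : Post L (Fin m) → ℕ
  | .eq x y => encL [0, x.val, y.val]
  | .rel r z => encL [1, encR ⟨_, r⟩, encL (List.ofFn fun i => (z i).val)]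
  | .por φ ψ => encL [2, encPost φ, encPost ψ]
  | .pnot φ => encL [3, encPost φ]

/-- Encoding of the initial-constants assignment. -/
def encInit {m : ℕ} (init : Fin m → L.Constants) : ℕ :=
  encL (List.ofFn fun i => encF ⟨0, init i⟩)

/-- Encoding of a verification-problem input (V, init, program, postcondition). -/
def encVerifInput {m : ℕ} (init : Fin m → L.Constants) (s : Prog L (Fin m))
    (φ : Post L (Fin m)) : ℕ :=
  encL [m, encInit encF init, encProg encF encR s, encPost encR φ]

/-- Encoding of a coherence-checking input (V, init, program). -/
def encCohInput {m : ℕ} (init : Fin m → L.Constants) (s : Prog L (Fin m)) : ℕ :=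
  encL [m, encInit encF init, encProg encF encR s]

end Enc

/-! ### Concretely presented finite signatures -/

/-- A concretely presented finite signature: the multisets of arities of function and
relation symbols, presented as lists. -/
structure FinSig where
  funcs : List ℕ
  rels : List ℕ

/-- The first-order language of a concretely presented finite signature. -/
abbrev FinSig.lang (S : FinSig) : FirstOrder.Language.{0,0} :=
  ⟨fun n => Fin (S.funcs.count n), fun n => Fin (S.rels.count n)⟩

/-- Canonical encoding of function symbols. -/
def FinSig.encF (S : FinSig) : (Σ n, (S.lang).Functions n) → ℕ :=
  fun x => encL [x.1, x.2.val]

/-- Canonical encoding of relation symbols. -/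
def FinSig.encR (S : FinSig) : (Σ n, (S.lang).Relations n) → ℕ :=
  fun x => encL [x.1, x.2.val]

/-- Canonical encoding of a finite signature. -/
def FinSig.enc (S : FinSig) : ℕ := encL [encL S.funcs, encL S.rels]

/-! ### EPR sentences -/

/-- Function-free terms: a variable among `k` universally quantified ones, or a constant. -/
abbrev EPRTerm (L : FirstOrder.Language.{0,0}) (k : ℕ) : Type := L.Constants ⊕ Fin k

/-- Interpretation of an EPR term as a first-order term. -/
def EPRTerm.toTerm {k : ℕ} : EPRTerm L k → L.Term (Empty ⊕ Fin k)
  | .inl c => Constants.term c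
  | .inr i => Term.var (Sum.inr i)

/-- Quantifier-free, function-free formulas with `k` variables. -/
inductive QFF (L : FirstOrder.Language.{0,0}) (k : ℕ) : Type where
  | eq (s t : EPRTerm L k)
  | rel {n : ℕ} (r : L.Relations n) (z : Fin n → EPRTerm L k)
  | or (φ ψ : QFF L k)
  | not (φ : QFF L k)

/-- Interpretation of a quantifier-free relational formula as a bounded formula. -/
def QFF.toBF {k : ℕ} : QFF L k → L.BoundedFormula Empty k
  | .eq s t => Term.bdEqual s.toTerm t.toTerm
  | .rel r z => BoundedFormula.rel r (fun i => (z i).toTerm)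
  | .or φ ψ => φ.toBF ⊔ ψ.toBF
  | .not φ => ∼φ.toBF

/-- An EPR sentence: the universal closure of a quantifier-free relational formula. -/
structure EPRAx (L : FirstOrder.Language.{0,0}) : Type where
  k : ℕ
  body : QFF L k

/-- The sentence denoted by an EPR axiom. -/
def EPRAx.toSentence (a : EPRAx L) : L.Sentence := a.body.toBF.alls

/-- The theory given by a finite list of EPR axioms. -/
def eprTheory (A : List (EPRAx L)) : L.Theory := { φ | ∃ a ∈ A, a.toSentence = φ }

/-- Canonical encoding of EPR terms over a concretely presented signature. -/
def encEPRTerm (S : FinSig) {k : ℕ} : EPRTerm S.lang k → ℕ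
  | .inl c => encL [0, c.val]
  | .inr i => encL [1, i.val]

/-- Canonical encoding of quantifier-free relational formulas. -/
def encQFF (S : FinSig) {k : ℕ} : QFF S.lang k → ℕ
  | .eq s t => encL [0, encEPRTerm S s, encEPRTerm S t]
  | .rel (n := n) r z => encL [1, n, r.val, encL (List.ofFn fun i => encEPRTerm S (z i))]
  | .or φ ψ => encL [2, encQFF S φ, encQFF S ψ]
  | .not φ => encL [3, encQFF S φ]

/-- Canonical encoding of EPR axioms. -/
def encEPRAx (S : FinSig) (a : EPRAx S.lang) : ℕ := encL [a.k, encQFF S a.body]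

end PVMA

namespace PVMA

open FirstOrder FirstOrder.Language

section Satisfaction

variable {L : FirstOrder.Language.{0,0}} (M : Struc L) (R : L.Relations 2)

theorem Struc.sat_phiIrref : M.Sat (phiIrref R) ↔ ∀ a, ¬ M.rel2 R a a := by
  let _ := M.inst
  simp [Struc.Sat, phiIrref, Struc.rel2, Sentence.Realize, Formula.Realize,
    BoundedFormula.realize_rel₂, Fin.snoc]

theorem Struc.sat_phiTrans : M.Sat (phiTrans R) ↔
    ∀ a b c, M.rel2 R a b → M.rel2 R b c → M.rel2 R a c := by
  let _ := M.inst
  simp [Struc.Sat, phiTrans, Struc.rel2, Sentence.Realize, Formula.Realize,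
    BoundedFormula.realize_rel₂, Fin.snoc]

theorem Struc.sat_phiTotal : M.Sat (phiTotal R) ↔
    ∀ a b, a = b ∨ M.rel2 R a b ∨ M.rel2 R b a := by
  let _ := M.inst
  simp [Struc.Sat, phiTotal, Struc.rel2, Sentence.Realize, Formula.Realize,
    BoundedFormula.realize_rel₂, Fin.snoc, or_assoc]

end Satisfaction

section WithRel

variable {L : FirstOrder.Language.{0,0}} (M : Struc L) (R : L.Relations 2)
  (r : M.carrier → M.carrier → Prop)

theorem Struc.relMap_withRel2_self (v : Fin 2 → M.carrier) :
    @Structure.RelMap L _ (M.withRel2 R r).inst 2 R v = r (v 0) (v 1) :=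
  dif_pos rfl

theorem Struc.relMap_withRel2_of_ne {n : ℕ} (S : L.Relations n)
    (h : (⟨n, S⟩ : Σ k, L.Relations k) ≠ ⟨2, R⟩) (v : Fin n → M.carrier) :
    @Structure.RelMap L _ (M.withRel2 R r).inst n S v =
      @Structure.RelMap L _ M.inst n S v :=
  dif_neg h

theorem Struc.rel2_withRel2 : (M.withRel2 R r).rel2 R = r :=
  funext fun a => funext fun b => M.relMap_withRel2_self R r ![a, b]

theorem Struc.realize_term_withRel2 {α : Type} (v : α → M.carrier) (t : L.Term α) :
    @Term.realize L _ (M.withRel2 R r).inst α v t = @Term.realize L _ M.inst α v t := by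
  induction t with
  | var => rfl
  | func f ts ih =>
    change M.inst.funMap f _ = M.inst.funMap f _
    congr 1
    funext i
    exact ih i

theorem Struc.evalT_withRel2 (t : L.Term Empty) : (M.withRel2 R r).evalT t = M.evalT t :=
  M.realize_term_withRel2 R r _ t

theorem Struc.realize_withRel2 {α : Type} {n : ℕ} (φ : L.BoundedFormula α n)
    (hφ : ¬ MentionsRel ⟨2, R⟩ φ) (v : α → M.carrier) (xs : Fin n → M.carrier) :
    @BoundedFormula.Realize L _ (M.withRel2 R r).inst α n φ v xs ↔
      @BoundedFormula.Realize L _ M.inst α n φ v xs := by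
  induction φ with
  | falsum => exact Iff.rfl
  | equal t₁ t₂ =>
    exact Iff.of_eq (congrArg₂ (@Eq M.carrier) (M.realize_term_withRel2 R r (Sum.elim v xs) t₁)
      (M.realize_term_withRel2 R r (Sum.elim v xs) t₂))
  | rel S ts =>
    exact Iff.of_eq ((M.relMap_withRel2_of_ne R r S hφ _).trans
      (congrArg (@Structure.RelMap L _ M.inst _ S)
        (funext fun i => M.realize_term_withRel2 R r (Sum.elim v xs) (ts i))))
  | imp φ ψ ihφ ihψ =>
    exact imp_congr (ihφ (fun h => hφ (Or.inl h)) xs) (ihψ (fun h => hφ (Or.inr h)) xs)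
  | all φ ih => exact forall_congr' fun a => ih hφ _

theorem Struc.satTheory_withRel2 {A : L.Theory} (hA : ∀ φ ∈ A, ¬ MentionsRel ⟨2, R⟩ φ)
    (hM : M.SatTheory A) : (M.withRel2 R r).SatTheory A :=
  fun φ hφ => (M.realize_withRel2 R r φ (hA φ hφ) _ _).2 (hM φ hφ)

/-- Enlarging the interpretation of `R` preserves every literal that is not a negated `R`-atom. -/
theorem Struc.satLit_withRel2 (hr : ∀ a b, M.rel2 R a b → r a b) {l : GLit L}
    (hl : ∀ ts, l ≠ GLit.nrel R ts) (h : M.SatLit l) : (M.withRel2 R r).SatLit l := by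
  cases l with
  | eq t₁ t₂ => exact (M.evalT_withRel2 R r t₁).trans (h.trans (M.evalT_withRel2 R r t₂).symm)
  | ne t₁ t₂ =>
    exact fun h' =>
      h ((M.evalT_withRel2 R r t₁).symm.trans (h'.trans (M.evalT_withRel2 R r t₂)))
  | @rel n S ts =>
    have hts := funext fun i => M.evalT_withRel2 R r (ts i)
    refine (congrArg (@Structure.RelMap L _ (M.withRel2 R r).inst n S) hts).mpr ?_
    by_cases hS : (⟨n, S⟩ : Σ k, L.Relations k) = ⟨2, R⟩
    · cases hS
      refine (M.relMap_withRel2_self R r _).mpr (hr _ _ ?_)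
      unfold Struc.rel2
      convert show @Structure.RelMap L _ M.inst 2 R fun i => M.evalT (ts i) from h using 1
      funext i
      fin_cases i <;> rfl
    · exact (M.relMap_withRel2_of_ne R r S hS _).mpr h
  | @nrel n S ts =>
    have hts := funext fun i => M.evalT_withRel2 R r (ts i)
    have hS : (⟨n, S⟩ : Σ k, L.Relations k) ≠ ⟨2, R⟩ := by
      intro hS
      cases hS
      exact hl ts rfl
    exact fun h' => h ((M.relMap_withRel2_of_ne R r S hS _).mp
      ((congrArg (@Structure.RelMap L _ (M.withRel2 R r).inst n S) hts).mp h'))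

end WithRel

/-- Every strict partial order extends to a strict total order. -/
theorem exists_strictTotal_extension {α : Type} (r : α → α → Prop) (hirr : ∀ a, ¬ r a a)
    (htr : ∀ a b c, r a b → r b c → r a c) :
    ∃ s : α → α → Prop, (∀ a b, r a b → s a b) ∧ (∀ a, ¬ s a a) ∧
      (∀ a b c, s a b → s b c → s a c) ∧ ∀ a b, a = b ∨ s a b ∨ s b a := by
  have : IsPartialOrder α fun a b => r a b ∨ a = b :=
    { refl := fun a => Or.inr rfl
      trans := by
        rintro a b c (h | rfl) (h' | rfl)
        exacts [Or.inl (htr _ _ _ h h'), Or.inl h, Or.inl h', Or.inr rfl]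
      antisymm := by
        rintro a b (h | h) (h' | h')
        exacts [(hirr _ (htr _ _ _ h h')).elim, h'.symm, h, h] }
  obtain ⟨s, hs, hrs⟩ := extend_partialOrder fun a b => r a b ∨ a = b
  refine ⟨fun a b => s a b ∧ a ≠ b, fun a b h => ⟨hrs _ _ (Or.inl h), ?_⟩,
    fun a h => h.2 rfl, ?_, fun a b => ?_⟩
  · rintro rfl
    exact hirr _ h
  · rintro a b c ⟨hab, hne⟩ ⟨hbc, -⟩
    refine ⟨_root_.trans hab hbc, ?_⟩
    rintro rfl
    exact hne (antisymm hab hbc)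
  · by_cases h : a = b
    · exact Or.inl h
    · exact Or.inr ((total_of s a b).imp (⟨·, h⟩) (⟨·, Ne.symm h⟩))

section Reduction

variable {L : FirstOrder.Language.{0,0}} {R : L.Relations 2} {A : L.Theory}

theorem Struc.SatTheory.mono {M : Struc L} {A B : L.Theory} (hM : M.SatTheory B) (h : A ⊆ B) :
    M.SatTheory A :=
  fun φ hφ => hM φ (h hφ)

theorem ASPO_subset_ASTO (R : L.Relations 2) : ASPO R ⊆ ASTO R := by
  rintro φ (rfl | rfl)
  exacts [Or.inl rfl, Or.inr (Or.inl rfl)]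

/-- A model whose `R` is a strict partial order becomes, by extending `R`, a model whose `R` is a
strict total order, with the same values of terms and at least the same literals that are not
negated `R`-atoms. -/
theorem exists_total_model (hA : ∀ φ ∈ A, ¬ MentionsRel ⟨2, R⟩ φ) (M : Struc L)
    (hM : M.SatTheory (A ∪ ASPO R)) :
    ∃ N : Struc L, N.SatTheory (A ∪ ASTO R) ∧
      (∀ t₁ t₂, N.evalT t₁ = N.evalT t₂ → M.evalT t₁ = M.evalT t₂) ∧
      ∀ l : GLit L, (∀ ts, l ≠ GLit.nrel R ts) → M.SatLit l → N.SatLit l := by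
  obtain ⟨s, hrs, hirr, htr, htot⟩ := exists_strictTotal_extension (M.rel2 R)
    ((M.sat_phiIrref R).1 (hM _ (Or.inr (Or.inl rfl))))
    ((M.sat_phiTrans R).1 (hM _ (Or.inr (Or.inr rfl))))
  have hs := M.rel2_withRel2 R s
  refine ⟨M.withRel2 R s, ?_, fun t₁ t₂ h => ?_, fun l hl h => M.satLit_withRel2 R s hrs hl h⟩
  · rintro φ (hφ | rfl | rfl | rfl)
    · exact M.satTheory_withRel2 R s hA (hM.mono Set.subset_union_left) φ hφ
    · rw [Struc.sat_phiIrref, hs]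
      exact hirr
    · rw [Struc.sat_phiTrans, hs]
      exact htr
    · rw [Struc.sat_phiTotal, hs]
      exact htot
  · rwa [M.evalT_withRel2 R s, M.evalT_withRel2 R s] at h

theorem entailsEq_ASTO_iff_ASPO (hA : ∀ φ ∈ A, ¬ MentionsRel ⟨2, R⟩ φ) {K : Set (GLit L)}
    (hK : ∀ ts, GLit.nrel R ts ∉ K) (t₁ t₂ : L.Term Empty) :
    EntailsEq (A ∪ ASTO R) K t₁ t₂ ↔ EntailsEq (A ∪ ASPO R) K t₁ t₂ := by
  refine ⟨fun h M hM hMK => ?_, fun h M hM hMK =>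
    h M (hM.mono (Set.union_subset_union_right A (ASPO_subset_ASTO R))) hMK⟩
  obtain ⟨N, hN, hval, hlit⟩ := exists_total_model hA M hM
  refine hval _ _ (h N hN fun l hl => hlit l ?_ (hMK l hl))
  rintro ts rfl
  exact hK ts hl

variable {V : Type} [DecidableEq V] {init : V → L.Constants} {ρ : Exec L V}

theorem feasibleIn_iff_kappa (M : Struc L) :
    FeasibleIn M init ρ ↔ ∀ l ∈ kappa init ρ, M.SatLit l :=
  ⟨fun h l ⟨σ, a, hp, hl⟩ => h σ a hp l hl, fun h σ a hp l hl => h l ⟨σ, a, hp, hl⟩⟩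

theorem nrel_notMem_kappa (hno : ∀ z : Fin 2 → V, ProgLetter.assumeNRel R z ∉ ρ)
    (ts : Fin 2 → L.Term Empty) : GLit.nrel R ts ∉ kappa init ρ := by
  rintro ⟨σ, a, hp, hl⟩
  have ha : a ∈ ρ := hp.subset (by simp)
  cases a with
  | assumeNRel S z =>
    simp only [litOf, Option.some.injEq, GLit.nrel.injEq] at hl
    obtain ⟨rfl, hS, -⟩ := hl
    obtain rfl := eq_of_heq hS
    exact hno z ha
  | _ => simp [litOf] at hl

theorem feasibleModulo_ASTO_iff_ASPO (hA : ∀ φ ∈ A, ¬ MentionsRel ⟨2, R⟩ φ)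
    (hno : ∀ z : Fin 2 → V, ProgLetter.assumeNRel R z ∉ ρ) :
    FeasibleModulo (A ∪ ASTO R) init ρ ↔ FeasibleModulo (A ∪ ASPO R) init ρ := by
  constructor
  · rintro ⟨M, hM, hρ⟩
    exact ⟨M, hM.mono (Set.union_subset_union_right A (ASPO_subset_ASTO R)), hρ⟩
  · rintro ⟨M, hM, hρ⟩
    obtain ⟨N, hN, -, hlit⟩ := exists_total_model hA M hM
    rw [feasibleIn_iff_kappa] at hρ
    refine ⟨N, hN, (feasibleIn_iff_kappa N).2 fun l hl => hlit l ?_ (hρ l hl)⟩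
    rintro ts rfl
    exact nrel_notMem_kappa hno ts hl

/-- Coherence depends only on the equalities entailed along the prefixes of the execution. -/
theorem Coherent.congr {A B : L.Theory}
    (h : ∀ σ, σ <+: ρ → ∀ t₁ t₂,
      EntailsEq A (kappa init σ) t₁ t₂ ↔ EntailsEq B (kappa init σ) t₁ t₂)
    (hc : Coherent A init ρ) : Coherent B init ρ := by
  constructor
  · intro σ x n f z hp
    have hσ := h σ ((List.prefix_append _ _).trans hp)
    have := hc.1 σ x f z hp
    simpa only [hσ] using this
  · intro σ a hp ha
    have hσ := h σ ((List.prefix_append _ _).trans hp)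
    have := hc.2 σ a hp ha
    simpa only [hσ, h _ hp] using this

end Reduction

/-- If no sentence of `A` mentions the binary relation symbol `R` and the
execution `ρ` contains no letter `assume(¬R(x,y))`, then (1) `ρ` is feasible modulo
`A ∪ A_STO^R` iff it is feasible modulo `A ∪ A_SPO^R`, and (2) `ρ` is coherent modulo
`A ∪ A_STO^R` iff it is coherent modulo `A ∪ A_SPO^R`. -/
theorem total_order_reduces_to_partial_order (L : FirstOrder.Language.{0,0}) (V : Type)
    [DecidableEq V] (R : L.Relations 2) (A : L.Theory)
    (hA : ∀ φ ∈ A, ¬ MentionsRel ⟨2, R⟩ φ)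
    (init : V → L.Constants) (ρ : Exec L V)
    (hno : ∀ z : Fin 2 → V, ProgLetter.assumeNRel R z ∉ ρ) :
    (FeasibleModulo (A ∪ ASTO R) init ρ ↔ FeasibleModulo (A ∪ ASPO R) init ρ) ∧
    (Coherent (A ∪ ASTO R) init ρ ↔ Coherent (A ∪ ASPO R) init ρ) := by
  have key : ∀ σ, σ <+: ρ → ∀ t₁ t₂,
      EntailsEq (A ∪ ASTO R) (kappa init σ) t₁ t₂ ↔
        EntailsEq (A ∪ ASPO R) (kappa init σ) t₁ t₂ := fun σ hσ =>
    entailsEq_ASTO_iff_ASPO hA (nrel_notMem_kappa fun z hz => hno z (hσ.subset hz))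
  exact ⟨feasibleModulo_ASTO_iff_ASPO hA hno,
    Coherent.congr key, Coherent.congr fun σ hσ t₁ t₂ => (key σ hσ t₁ t₂).symm⟩

end PVMA
end

section
/- Let ρ be an execution. If there is a Σ-structure M such that ρ is feasible in M, then ρ is feasible in the minimal model M_ρ. -/
namespace PVMA

open FirstOrder FirstOrder.Language

theorem Struc.evalT_func {L : FirstOrder.Language.{0,0}} (M : Struc L) {n : ℕ}
    (f : L.Functions n) (ts : Fin n → L.Term Empty) :
    M.evalT (.func f ts) =
      @Structure.funMap L M.carrier M.inst n f fun i => M.evalT (ts i) := rfl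

/-- A structure satisfying the generating equalities satisfies their congruence closure. -/
theorem CongCl.evalT_eq {L : FirstOrder.Language.{0,0}}
    {E : L.Term Empty → L.Term Empty → Prop} {M : Struc L}
    (hE : ∀ t₁ t₂, E t₁ t₂ → M.evalT t₁ = M.evalT t₂) {t₁ t₂ : L.Term Empty}
    (h : CongCl E t₁ t₂) : M.evalT t₁ = M.evalT t₂ := by
  induction h with
  | base h => exact hE _ _ h
  | refl => rfl
  | symm _ ih => exact ih.symm
  | trans _ _ ih₁ ih₂ => exact ih₁.trans ih₂
  | congr f _ ih => rw [Struc.evalT_func, Struc.evalT_func, funext ih]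

/-- Feasibility in `M` amounts to `M` satisfying all accumulated literals. -/
theorem feasibleIn_iff_forall_kappa {L : FirstOrder.Language.{0,0}} {V : Type} [DecidableEq V]
    {M : Struc L} {init : V → L.Constants} {ρ : Exec L V} :
    FeasibleIn M init ρ ↔ ∀ l ∈ kappa init ρ, M.SatLit l :=
  ⟨fun h _ ⟨σ, a, hp, hl⟩ => h σ a hp _ hl, fun h σ a hp l hl => h l ⟨σ, a, hp, hl⟩⟩

section minimalModel

variable {L : FirstOrder.Language.{0,0}} {V : Type} [DecidableEq V] [Nonempty V]
  (init : V → L.Constants) (ρ : Exec L V)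

/-- In the minimal model every ground term evaluates to its own class. -/
theorem minimalModel_evalT (t : L.Term Empty) :
    (minimalModel init ρ).evalT t =
      Quotient.mk (congSetoid (eqPairs (kappa init ρ))) t := by
  induction t with
  | var e => exact e.elim
  | func f ts ih =>
    rw [Struc.evalT_func, funext ih]
    exact Quotient.sound (s := congSetoid (eqPairs (kappa init ρ)))
      (CongCl.congr f fun i => Quotient.mk_out (s := congSetoid (eqPairs (kappa init ρ))) (ts i))

theorem minimalModel_evalT_eq_iff {t₁ t₂ : L.Term Empty} :
    (minimalModel init ρ).evalT t₁ = (minimalModel init ρ).evalT t₂ ↔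
      CongCl (eqPairs (kappa init ρ)) t₁ t₂ := by
  rw [minimalModel_evalT, minimalModel_evalT]
  exact Quotient.eq (r := congSetoid (eqPairs (kappa init ρ)))

theorem minimalModel_relMap_iff {n : ℕ} (r : L.Relations n) (ts : Fin n → L.Term Empty) :
    @Structure.RelMap L (minimalModel init ρ).carrier (minimalModel init ρ).inst n r
        (fun i => (minimalModel init ρ).evalT (ts i)) ↔
      ∃ ss : Fin n → L.Term Empty,
        (∀ i, CongCl (eqPairs (kappa init ρ)) (ss i) (ts i)) ∧ GLit.rel r ss ∈ kappa init ρ := by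
  simp only [← minimalModel_evalT_eq_iff, minimalModel_evalT]
  rfl

end minimalModel

/-- If an execution is feasible in some structure, then it is feasible in
its minimal model. -/
theorem feasible_in_minimal_model (L : FirstOrder.Language.{0,0}) (V : Type)
    [DecidableEq V] [Nonempty V] (init : V → L.Constants) (ρ : Exec L V)
    (h : ∃ M : Struc L, FeasibleIn M init ρ) :
    FeasibleIn (minimalModel init ρ) init ρ := by
  obtain ⟨M, hM⟩ := h
  rw [feasibleIn_iff_forall_kappa] at hM ⊢
  have hcong {t₁ t₂ : L.Term Empty} (ht : CongCl (eqPairs (kappa init ρ)) t₁ t₂) :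
      M.evalT t₁ = M.evalT t₂ := ht.evalT_eq fun s₁ s₂ he => hM (.eq s₁ s₂) he
  intro l hl
  cases l with
  | eq t₁ t₂ => exact (minimalModel_evalT_eq_iff init ρ).2 (.base hl)
  | ne t₁ t₂ => exact fun he => hM _ hl (hcong ((minimalModel_evalT_eq_iff init ρ).1 he))
  | rel r ts => exact (minimalModel_relMap_iff init ρ r ts).2 ⟨ts, fun i => .refl _, hl⟩
  | nrel r ts =>
    intro hr
    obtain ⟨ss, hss, hmem⟩ := (minimalModel_relMap_iff init ρ r ts).1 hr
    refine hM _ hl ?_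
    rw [← funext fun i => hcong (hss i)]
    exact hM _ hmem

end PVMA
end

section
/- Let M be a Σ-structure and M' = 1Ext(M) its one-element extension. Then: (i) for every ground Σ-term t, ⟦t⟧_{M'} = ⟦t⟧_M ∈ U_M; (ii) for every quantifier-free (ground) Σ-sentence φ, if M ⊨ φ then M' ⊨ φ; (iii) for every binary function symbol f, if M ⊨ φ_comm^f then M' ⊨ φ_comm^f, and for every unary function symbol f, if M ⊨ φ_idem^f then M' ⊨ φ_idem^f; (iv) for every binary relation symbol R, if M ⊨ φ_trans^R then M' ⊨ φ_trans^R. Consequently the singleton sets {φ_comm^f}, {φ_idem^f}, {φ_trans^R}, and any set of quantifier-free ground sentences, are invariant under 1-element extension. -/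
namespace PVMA

open FirstOrder FirstOrder.Language

theorem sat_phiComm_iff {L : FirstOrder.Language.{0,0}} (M : Struc L) (f : L.Functions 2) :
    M.Sat (phiComm f) ↔
      ∀ a b, M.inst.funMap f ![a, b] = M.inst.funMap f ![b, a] := by
  let := M.inst
  simp [Struc.Sat, phiComm, Sentence.Realize, Formula.Realize, Fin.snoc]

theorem sat_phiIdem_iff {L : FirstOrder.Language.{0,0}} (M : Struc L) (f : L.Functions 1) :
    M.Sat (phiIdem f) ↔
      ∀ a, M.inst.funMap f ![M.inst.funMap f ![a] ] = M.inst.funMap f ![a] := by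
  let := M.inst
  simp [Struc.Sat, phiIdem, Sentence.Realize, Formula.Realize, Fin.snoc]

theorem sat_phiTrans_iff {L : FirstOrder.Language.{0,0}} (M : Struc L) (R : L.Relations 2) :
    M.Sat (phiTrans R) ↔
      ∀ a b c, M.rel2 R a b → M.rel2 R b c → M.rel2 R a c := by
  let := M.inst
  simp [Struc.Sat, Struc.rel2, phiTrans, Sentence.Realize, Formula.Realize, Fin.snoc,
    BoundedFormula.realize_rel₂]

theorem oneExt_funMap_some {L : FirstOrder.Language.{0,0}}
    (M : Struc L) {n : ℕ} (f : L.Functions n) (v : Fin n → M.carrier) :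
    (oneExt M).inst.funMap f (fun i => some (v i)) = some (M.inst.funMap f v) :=
  dif_pos fun _ => rfl

theorem oneExt_funMap_none {L : FirstOrder.Language.{0,0}} (M : Struc L) {n : ℕ} (f : L.Functions n)
    (v : Fin n → (oneExt M).carrier) {i : Fin n} (hi : v i = none) :
    (oneExt M).inst.funMap f v = none :=
  dif_neg fun h => by simpa [hi] using h i

/-- The canonical embedding of a structure into its one-element extension. -/
def oneExtEmbedding {L : FirstOrder.Language.{0,0}} (M : Struc L) :
    letI := M.inst
    letI := (oneExt M).inst
    M.carrier ↪[L] (oneExt M).carrier :=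
  letI := M.inst
  letI := (oneExt M).inst
  { toFun := some
    inj' := Option.some_injective _
    map_fun' := fun f v => (oneExt_funMap_some M f v).symm
    map_rel' := fun R v => by
      constructor
      · rintro ⟨w, hw, hR⟩
        rwa [show v = w from funext fun i => Option.some_injective _ (hw i)]
      · exact fun hR => ⟨v, fun _ => rfl, hR⟩ }

theorem oneExt_evalT {L : FirstOrder.Language.{0,0}} (M : Struc L) (t : L.Term Empty) :
    (oneExt M).evalT t = some (M.evalT t) := by
  let := M.inst
  let := (oneExt M).inst
  have h := HomClass.realize_term (oneExtEmbedding M) (t := t) (v := Empty.elim)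
  rwa [Subsingleton.elim (oneExtEmbedding M ∘ Empty.elim) Empty.elim] at h

theorem oneExt_sat_iff_of_isQF {L : FirstOrder.Language.{0,0}}
    (M : Struc L) {φ : L.Sentence} (hφ : φ.IsQF) :
    (oneExt M).Sat φ ↔ M.Sat φ := by
  let := M.inst
  let := (oneExt M).inst
  have h := hφ.realize_embedding (oneExtEmbedding M) (v := default) (xs := default)
  rwa [Subsingleton.elim (oneExtEmbedding M ∘ default) default,
    Subsingleton.elim (oneExtEmbedding M ∘ default) default] at h

theorem oneExt_sat_phiComm {L : FirstOrder.Language.{0,0}}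
    {M : Struc L} {f : L.Functions 2} (h : M.Sat (phiComm f)) :
    (oneExt M).Sat (phiComm f) := by
  rw [sat_phiComm_iff] at h ⊢
  rintro (_ | a) (_ | b)
  · rfl
  · rw [oneExt_funMap_none M f _ (i := 0) rfl, oneExt_funMap_none M f _ (i := 1) rfl]
  · rw [oneExt_funMap_none M f _ (i := 1) rfl, oneExt_funMap_none M f _ (i := 0) rfl]
  · have key : ∀ x y : M.carrier, (oneExt M).inst.funMap f ![some x, some y] =
        some (M.inst.funMap f ![x, y]) := fun x y => by
      rw [← oneExt_funMap_some]
      exact congrArg _ (by ext i : 1; fin_cases i <;> rfl)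
    exact (key a b).trans ((congrArg some (h a b)).trans (key b a).symm)

theorem oneExt_sat_phiIdem {L : FirstOrder.Language.{0,0}}
    {M : Struc L} {f : L.Functions 1} (h : M.Sat (phiIdem f)) :
    (oneExt M).Sat (phiIdem f) := by
  rw [sat_phiIdem_iff] at h ⊢
  rintro (_ | a)
  · have key : (oneExt M).inst.funMap f ![none] = none := oneExt_funMap_none M f _ (i := 0) rfl
    exact congrArg (fun x => (oneExt M).inst.funMap f ![x]) key
  · have key : ∀ x : M.carrier, (oneExt M).inst.funMap f ![some x] =
        some (M.inst.funMap f ![x]) := fun x => by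
      rw [← oneExt_funMap_some]
      exact congrArg _ (by ext i : 1; fin_cases i; rfl)
    have hk := congrArg (fun x => (oneExt M).inst.funMap f ![x]) (key a)
    exact hk.trans ((key _).trans ((congrArg some (h a)).trans (key a).symm))

theorem oneExt_rel2_iff {L : FirstOrder.Language.{0,0}}
    (M : Struc L) (R : L.Relations 2) (x y : (oneExt M).carrier) :
    (oneExt M).rel2 R x y ↔ ∃ a b, x = some a ∧ y = some b ∧ M.rel2 R a b := by
  constructor
  · rintro ⟨w, hw, hR⟩
    refine ⟨w 0, w 1, hw 0, hw 1, ?_⟩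
    rwa [Struc.rel2, show ![w 0, w 1] = w by ext i : 1; fin_cases i <;> rfl]
  · rintro ⟨a, b, rfl, rfl, hR⟩
    exact ⟨![a, b], fun i => by fin_cases i <;> rfl, hR⟩

theorem oneExt_sat_phiTrans {L : FirstOrder.Language.{0,0}}
    {M : Struc L} {R : L.Relations 2} (h : M.Sat (phiTrans R)) :
    (oneExt M).Sat (phiTrans R) := by
  rw [sat_phiTrans_iff] at h ⊢
  intro x y z hxy hyz
  obtain ⟨a, b, rfl, rfl, hab⟩ := (oneExt_rel2_iff M R x y).1 hxy
  obtain ⟨b', c, hb, rfl, hbc⟩ := (oneExt_rel2_iff M R _ z).1 hyz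
  obtain rfl := Option.some_injective _ hb
  exact (oneExt_rel2_iff M R _ _).2 ⟨a, c, rfl, rfl, h a b c hab hbc⟩

theorem invariant1Ext_of_forall {L : FirstOrder.Language.{0,0}} {A : L.Theory}
    (h : ∀ (M : Struc L), ∀ φ ∈ A, M.Sat φ → (oneExt M).Sat φ) : Invariant1Ext A :=
  fun M hM φ hφ => h M φ hφ (hM φ hφ)

/-- Properties of the one-element extension `1Ext(M)`:
(i) ground terms evaluate as in `M`; (ii) quantifier-free (ground) sentences true in `M`
remain true in `1Ext(M)`; (iii) commutativity and idempotence axioms are preserved;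
(iv) transitivity axioms are preserved. Consequently the singleton sets `{φ_comm^f}`,
`{φ_idem^f}`, `{φ_trans^R}`, and any set of quantifier-free sentences, are invariant under
one-element extension. -/
theorem one_element_extension_properties (L : FirstOrder.Language.{0,0}) :
    (∀ (M : Struc L) (t : L.Term Empty), (oneExt M).evalT t = some (M.evalT t)) ∧
    (∀ (M : Struc L) (φ : L.Sentence), φ.IsQF → M.Sat φ → (oneExt M).Sat φ) ∧
    (∀ (M : Struc L) (f : L.Functions 2), M.Sat (phiComm f) → (oneExt M).Sat (phiComm f)) ∧
    (∀ (M : Struc L) (f : L.Functions 1), M.Sat (phiIdem f) → (oneExt M).Sat (phiIdem f)) ∧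
    (∀ (M : Struc L) (R : L.Relations 2), M.Sat (phiTrans R) → (oneExt M).Sat (phiTrans R)) ∧
    (∀ f : L.Functions 2, Invariant1Ext ({phiComm f} : L.Theory)) ∧
    (∀ f : L.Functions 1, Invariant1Ext ({phiIdem f} : L.Theory)) ∧
    (∀ R : L.Relations 2, Invariant1Ext ({phiTrans R} : L.Theory)) ∧
    (∀ A : L.Theory, (∀ φ ∈ A, φ.IsQF) → Invariant1Ext A) := by
  refine ⟨oneExt_evalT, fun M _ hφ => (oneExt_sat_iff_of_isQF M hφ).2,
    fun _ _ => oneExt_sat_phiComm, fun _ _ => oneExt_sat_phiIdem, fun _ _ => oneExt_sat_phiTrans,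
    fun f => invariant1Ext_of_forall ?_, fun f => invariant1Ext_of_forall ?_,
    fun R => invariant1Ext_of_forall ?_,
    fun A hA => invariant1Ext_of_forall fun M φ hφ => (oneExt_sat_iff_of_isQF M (hA φ hφ)).2⟩
  · rintro M _ rfl
    exact oneExt_sat_phiComm
  · rintro M _ rfl
    exact oneExt_sat_phiIdem
  · rintro M _ rfl
    exact oneExt_sat_phiTrans

end PVMA
end
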